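/- For every integer n ≥ 3 and every vertex u ∈ V, the probability of the event E_{3,u} — that there exists a four-cycle rooted at u whose edge sequence pattern (writing s for a local edge and w for a long-range edge) is (s,s,w,w) or (w,w,s,s) — satisfies Pr(E_{3,u}) < (6·ζ(3) + 3/4) · ln(n/2)^{−2}. -/

import Mathlib

open scoped Classical
open Finset

/-- Vertex set of the `n × n` torus. -/
abbrev Vx (n : ℕ) := Fin n × Fin n

/-- Toroidal distance on the `n × n` torus. -/
def tdist (n : ℕ) (u v : Vx n) : ℕ :=
  min ((u.1 : ℤ) - (v.1 : ℤ)).natAbs (n - ((u.1 : ℤ) - (v.1 : ℤ)).natAbs) +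
  min ((u.2 : ℤ) - (v.2 : ℤ)).natAbs (n - ((u.2 : ℤ) - (v.2 : ℤ)).natAbs)

/-- The normalizing factor at vertex `u`. -/
noncomputable def Zfac (n : ℕ) (u : Vx n) : ℝ :=
  (∑ w ∈ univ.filter (fun w => w ≠ u), ((tdist n u w : ℝ) ^ 2)⁻¹)⁻¹

/-- The probability mass of the outcome `c : V → V` (the vector of long-range choices)
under the UTSW product measure: each vertex `u` independently chooses `c u = v ≠ u`
with probability `Z · d(u,v)⁻²`. -/
noncomputable def mass (n : ℕ) (c : Vx n → Vx n) : ℝ :=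
  ∏ u : Vx n, if c u = u then 0 else Zfac n u * ((tdist n u (c u) : ℝ) ^ 2)⁻¹

/-- Probability of an event under the UTSW product measure. -/
noncomputable def Pr (n : ℕ) (E : Set (Vx n → Vx n)) : ℝ :=
  ∑ c : Vx n → Vx n, if c ∈ E then mass n c else 0

/-- `{x, y}` is an edge of the UTSW random graph `G(c)`. -/
def isEdge (n : ℕ) (c : Vx n → Vx n) (x y : Vx n) : Prop :=
  x ≠ y ∧ (tdist n x y = 1 ∨ c x = y ∨ c y = x)

/-- `{x, y}` is an edge of `G(c)` of the given kind: local (`w = false`, distance one)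
or long-range (`w = true`, distance not one). -/
def edgeKind (n : ℕ) (c : Vx n → Vx n) (x y : Vx n) (w : Bool) : Prop :=
  isEdge n c x y ∧ (tdist n x y = 1 ↔ w = false)

/-- There is a four-cycle rooted at `u` in `G(c)` whose edge sequence has the local/long-range
pattern `(p₁, p₂, p₃, p₄)` (`false` = local edge, `true` = long-range edge). -/
def cyclePat (n : ℕ) (c : Vx n → Vx n) (u : Vx n) (p₁ p₂ p₃ p₄ : Bool) : Prop :=
  ∃ a b e : Vx n, a ≠ b ∧ a ≠ e ∧ b ≠ e ∧ a ≠ u ∧ b ≠ u ∧ e ≠ u ∧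
    edgeKind n c u a p₁ ∧ edgeKind n c a b p₂ ∧ edgeKind n c b e p₃ ∧ edgeKind n c e u p₄

/-- `ζ(3) = ∑_{i ≥ 1} i⁻³`. -/
noncomputable def zeta3 : ℝ := ∑' i : ℕ, ((i + 1 : ℝ) ^ 3)⁻¹


section TorusNorm

/-- Distance to `0` on the cycle of length `n`. -/
def cycNorm {n : ℕ} (x : Fin n) : ℕ := min x.val (n - x.val)

/-- Toroidal distance to the origin. -/
def torusNorm {n : ℕ} (w : Vx n) : ℕ := cycNorm w.1 + cycNorm w.2

lemma cycNorm_sub {n : ℕ} [NeZero n] (x y : Fin n) :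
    cycNorm (x - y) = min ((x : ℤ) - (y : ℤ)).natAbs (n - ((x : ℤ) - (y : ℤ)).natAbs) := by
  have hx := x.isLt
  have hy := y.isLt
  unfold cycNorm
  rcases le_or_gt y x with h | h
  · have h' : (y : ℕ) ≤ x := h
    rw [Fin.sub_val_of_le h]
    omega
  · have h' : (x : ℕ) < y := h
    rw [Fin.val_sub, Nat.mod_eq_of_lt (by omega)]
    omega

lemma tdist_eq_torusNorm {n : ℕ} [NeZero n] (u v : Vx n) : tdist n u v = torusNorm (u - v) := by
  simp only [tdist, torusNorm, Prod.fst_sub, Prod.snd_sub, cycNorm_sub]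

lemma tdist_comm {n : ℕ} (u v : Vx n) : tdist n u v = tdist n v u := by
  unfold tdist
  omega

lemma tdist_self {n : ℕ} (u : Vx n) : tdist n u u = 0 := by simp [tdist]

lemma cycNorm_eq_zero {n : ℕ} [NeZero n] {x : Fin n} (h : cycNorm x = 0) : x = 0 := by
  have := x.isLt
  unfold cycNorm at h
  ext
  simp only [Fin.val_zero]
  omega

lemma cycNorm_eq_one {n : ℕ} [NeZero n] {x : Fin n} (h : cycNorm x = 1) : x = 1 ∨ x = -1 := by
  have hx := x.isLt
  unfold cycNorm at h
  have hn : 1 < n := by omega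
  have h1 : ((1 : Fin n) : ℕ) = 1 := by rw [Fin.val_one', Nat.mod_eq_of_lt hn]
  by_cases h2 : (x : ℕ) = 1
  · left; ext; omega
  · right
    rw [eq_neg_iff_add_eq_zero]
    ext
    rw [Fin.val_add, h1, show (x : ℕ) + 1 = n by omega]
    simp

/-- The number of points of the infinite path `ℤ` at distance `j` from `0`. -/
def lineSphere (j : ℕ) : ℕ := if j = 0 then 1 else 2

lemma card_cycNorm_le {n : ℕ} [NeZero n] (j : ℕ) :
    #{x : Fin n | cycNorm x = j} ≤ lineSphere j := by
  unfold lineSphere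
  split_ifs with h
  · refine (card_le_card (t := {0}) fun x hx => ?_).trans (by simp)
    simp only [mem_filter, mem_univ, true_and] at hx
    simp [cycNorm_eq_zero (hx.trans h)]
  · refine (card_le_card (t := {Fin.ofNat n j, Fin.ofNat n (n - j)}) fun x hx => ?_).trans
      card_le_two
    rw [mem_filter_univ, cycNorm] at hx
    have := x.isLt
    simp only [mem_insert, mem_singleton, Fin.ext_iff, Fin.val_ofNat]
    rw [Nat.mod_eq_of_lt (a := n - j) (by omega), Nat.mod_eq_of_lt (a := j) (by omega)]
    omega

lemma lineSphere_le_card {n : ℕ} [NeZero n] {j : ℕ} (hj : 2 * j < n) :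
    lineSphere j ≤ #{x : Fin n | cycNorm x = j} := by
  unfold lineSphere
  split_ifs with h
  · rw [Nat.one_le_iff_ne_zero, ← Nat.pos_iff_ne_zero, card_pos]
    exact ⟨0, by simp [cycNorm, h]⟩
  · have hne : (⟨j, by omega⟩ : Fin n) ≠ ⟨n - j, by omega⟩ := by
      simp only [ne_eq, Fin.mk.injEq]
      omega
    rw [← card_pair hne]
    refine card_le_card fun x hx => ?_
    simp only [mem_insert, mem_singleton] at hx
    rw [mem_filter_univ, cycNorm]
    rcases hx with rfl | rfl <;> simp only <;> omega

lemma sum_antidiagonal_lineSphere {i : ℕ} (hi : i ≠ 0) :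
    ∑ p ∈ antidiagonal i, lineSphere p.1 * lineSphere p.2 = 4 * i := by
  obtain ⟨k, rfl⟩ := Nat.exists_eq_succ_of_ne_zero hi
  rw [Nat.succ_eq_add_one, Nat.sum_antidiagonal_succ]
  cases k with
  | zero => simp [lineSphere]
  | succ k =>
    rw [Nat.sum_antidiagonal_succ']
    simp [lineSphere]
    ring

lemma card_torusNorm {n : ℕ} (i : ℕ) :
    #{w : Vx n | torusNorm w = i} = ∑ p ∈ antidiagonal i,
      #{x : Fin n | cycNorm x = p.1} * #{x : Fin n | cycNorm x = p.2} := by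
  rw [card_eq_sum_card_fiberwise (f := fun w : Vx n => (cycNorm w.1, cycNorm w.2))
    (t := antidiagonal i)]
  · refine sum_congr rfl fun p hp => ?_
    rw [← card_product]
    congr 1
    ext w
    rw [HasAntidiagonal.mem_antidiagonal] at hp
    simp only [mem_filter, mem_univ, true_and, mem_product, Prod.ext_iff]
    rw [torusNorm]
    omega
  · intro w hw
    simpa [torusNorm] using (mem_filter_univ w).1 hw

lemma card_torusNorm_le {n : ℕ} [NeZero n] {i : ℕ} (hi : i ≠ 0) :
    #{w : Vx n | torusNorm w = i} ≤ 4 * i := by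
  rw [card_torusNorm, ← sum_antidiagonal_lineSphere hi]
  exact sum_le_sum fun p _ => Nat.mul_le_mul (card_cycNorm_le _) (card_cycNorm_le _)

lemma le_card_torusNorm {n : ℕ} [NeZero n] {i : ℕ} (hi : i ≠ 0) (hn : 2 * i < n) :
    4 * i ≤ #{w : Vx n | torusNorm w = i} := by
  rw [card_torusNorm, ← sum_antidiagonal_lineSphere hi]
  refine sum_le_sum fun p hp => ?_
  rw [HasAntidiagonal.mem_antidiagonal] at hp
  exact Nat.mul_le_mul (lineSphere_le_card (by omega)) (lineSphere_le_card (by omega))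

lemma sum_comp_torusNorm {n : ℕ} (g : ℕ → ℝ) :
    ∑ w : Vx n, g (torusNorm w) =
      ∑ i ∈ range (n + 1), (#{w : Vx n | torusNorm w = i} : ℝ) * g i := by
  rw [← sum_fiberwise_of_maps_to (s := univ) (t := range (n + 1)) (g := torusNorm)]
  · refine sum_congr rfl fun i _ => ?_
    rw [sum_congr rfl (g := fun _ => g i), sum_const, nsmul_eq_mul]
    intro w hw
    rw [(mem_filter.1 hw).2]
  · intro w _
    have h1 := w.1.isLt
    have h2 := w.2.isLt
    simp only [mem_range, torusNorm, cycNorm]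
    omega

lemma summable_zeta3 : Summable fun i : ℕ => ((i + 1 : ℝ) ^ 3)⁻¹ := by
  have h := (summable_nat_add_iff 1).2 (Real.summable_nat_pow_inv.2 (by norm_num : 1 < 3))
  simpa using h

lemma sum_torusNorm_inv_pow_four_le {n : ℕ} [NeZero n] :
    ∑ w : Vx n, ((torusNorm w : ℝ) ^ 4)⁻¹ ≤ 4 * zeta3 := by
  rw [sum_comp_torusNorm fun i => ((i : ℝ) ^ 4)⁻¹, sum_range_succ']
  simp only [Nat.cast_zero, ne_eq, OfNat.ofNat_ne_zero, not_false_eq_true, zero_pow, inv_zero,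
    mul_zero, add_zero]
  calc _ ≤ ∑ i ∈ range n, 4 * ((i + 1 : ℝ) ^ 3)⁻¹ := by
        refine sum_le_sum fun i _ => ?_
        have h : (#{w : Vx n | torusNorm w = i + 1} : ℝ) ≤ 4 * (i + 1 : ℝ) := by
          exact_mod_cast card_torusNorm_le (n := n) (Nat.succ_ne_zero i)
        push_cast
        calc _ ≤ 4 * (i + 1 : ℝ) * ((i + 1 : ℝ) ^ 4)⁻¹ := by gcongr
          _ = _ := by field_simp
    _ = 4 * ∑ i ∈ range n, ((i + 1 : ℝ) ^ 3)⁻¹ := by rw [mul_sum]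
    _ ≤ _ := by
        gcongr
        exact summable_zeta3.sum_le_tsum _ fun i _ => by positivity

lemma le_sum_torusNorm_inv_sq {n : ℕ} [NeZero n] :
    4 * Real.log ((n : ℝ) / 2) ≤ ∑ w : Vx n, ((torusNorm w : ℝ) ^ 2)⁻¹ := by
  have hn : 0 < n := Nat.pos_of_neZero n
  obtain ⟨m, hm⟩ : ∃ m, m = (n - 1) / 2 := ⟨_, rfl⟩
  have hlog : Real.log ((n : ℝ) / 2) ≤ ∑ i ∈ range m, (i + 1 : ℝ)⁻¹ := by
    calc _ ≤ Real.log ((m + 1 : ℕ) : ℝ) := by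
          apply Real.log_le_log (by positivity)
          rw [div_le_iff₀ two_pos]
          exact_mod_cast (by omega : n ≤ (m + 1) * 2)
      _ ≤ harmonic m := log_add_one_le_harmonic m
      _ = _ := by simp [harmonic]
  calc _ ≤ 4 * ∑ i ∈ range m, (i + 1 : ℝ)⁻¹ := by gcongr
    _ = ∑ i ∈ range m, 4 * (i + 1 : ℝ)⁻¹ := mul_sum _ _ _
    _ ≤ ∑ i ∈ range m, (#{w : Vx n | torusNorm w = i + 1} : ℝ) * (((i + 1 : ℕ) : ℝ) ^ 2)⁻¹ := by
        refine sum_le_sum fun i hi => ?_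
        rw [mem_range] at hi
        have h : 4 * (i + 1 : ℝ) ≤ (#{w : Vx n | torusNorm w = i + 1} : ℝ) := by
          exact_mod_cast le_card_torusNorm (n := n) (Nat.succ_ne_zero i) (by omega)
        push_cast
        calc _ = 4 * (i + 1 : ℝ) * ((i + 1 : ℝ) ^ 2)⁻¹ := by field_simp
          _ ≤ _ := by gcongr
    _ ≤ ∑ i ∈ range n, (#{w : Vx n | torusNorm w = i + 1} : ℝ) * (((i + 1 : ℕ) : ℝ) ^ 2)⁻¹ :=
        sum_le_sum_of_subset_of_nonneg (range_subset_range.2 (by omega))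
          fun _ _ _ => by positivity
    _ = _ := by
        rw [sum_comp_torusNorm fun i => ((i : ℝ) ^ 2)⁻¹, sum_range_succ']
        simp

end TorusNorm

section Weights

variable {n : ℕ}

lemma sum_comp_tdist [NeZero n] (g : ℕ → ℝ) (u : Vx n) :
    ∑ w, g (tdist n u w) = ∑ w : Vx n, g (torusNorm w) := by
  simp only [tdist_eq_torusNorm]
  exact Equiv.sum_comp (Equiv.subLeft u) fun w => g (torusNorm w)

/-- The probability that the long-range choice of `u` is `v`. -/
noncomputable def choiceProb (n : ℕ) (u v : Vx n) : ℝ :=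
  Zfac n u * ((tdist n u v : ℝ) ^ 2)⁻¹

lemma mass_eq_prod (c : Vx n → Vx n) : mass n c = ∏ u, choiceProb n u (c u) := by
  refine prod_congr rfl fun u _ => ?_
  split_ifs with h
  · simp [choiceProb, h, tdist_self]
  · rfl

lemma Zfac_eq [NeZero n] (u : Vx n) :
    Zfac n u = (∑ w : Vx n, ((torusNorm w : ℝ) ^ 2)⁻¹)⁻¹ := by
  rw [Zfac, ← sum_comp_tdist (fun i => ((i : ℝ) ^ 2)⁻¹) u, sum_filter_of_ne]
  rintro w - h rfl
  simp [tdist_self] at h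

lemma Zfac_nonneg (u : Vx n) : 0 ≤ Zfac n u :=
  inv_nonneg.2 (sum_nonneg fun _ _ => by positivity)

lemma choiceProb_nonneg (u v : Vx n) : 0 ≤ choiceProb n u v :=
  mul_nonneg (Zfac_nonneg u) (by positivity)

lemma log_half_pos (hn : 3 ≤ n) : 0 < Real.log ((n : ℝ) / 2) := by
  have h : (3 : ℝ) ≤ n := by exact_mod_cast hn
  exact Real.log_pos (by linarith)

lemma Zfac_le [NeZero n] (hn : 3 ≤ n) (u : Vx n) :
    Zfac n u ≤ (4 * Real.log ((n : ℝ) / 2))⁻¹ := by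
  have := log_half_pos hn
  rw [Zfac_eq]
  exact inv_anti₀ (by positivity) le_sum_torusNorm_inv_sq

lemma sum_choiceProb [NeZero n] (hn : 3 ≤ n) (u : Vx n) : ∑ v, choiceProb n u v = 1 := by
  have := log_half_pos hn
  have h := le_sum_torusNorm_inv_sq (n := n)
  simp only [choiceProb]
  rw [← mul_sum, sum_comp_tdist (fun i => ((i : ℝ) ^ 2)⁻¹) u, Zfac_eq, inv_mul_cancel₀]
  linarith

lemma mass_nonneg (c : Vx n → Vx n) : 0 ≤ mass n c := by
  rw [mass_eq_prod]
  exact prod_nonneg fun _ _ => choiceProb_nonneg _ _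

lemma Pr_mono {E F : Set (Vx n → Vx n)} (h : E ⊆ F) : Pr n E ≤ Pr n F := by
  refine sum_le_sum fun c _ => ?_
  by_cases hc : c ∈ E
  · simp [hc, h hc]
  · rw [if_neg hc]
    split_ifs
    exacts [mass_nonneg c, le_rfl]

lemma Pr_union_le (E F : Set (Vx n → Vx n)) : Pr n (E ∪ F) ≤ Pr n E + Pr n F := by
  rw [Pr, Pr, Pr, ← sum_add_distrib]
  refine sum_le_sum fun c _ => ?_
  have := mass_nonneg c
  by_cases h1 : c ∈ E <;> by_cases h2 : c ∈ F <;> simp [h1, h2, this]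

lemma Pr_biUnion_le {ι : Type*} (s : Finset ι) (E : ι → Set (Vx n → Vx n)) :
    Pr n (⋃ i ∈ s, E i) ≤ ∑ i ∈ s, Pr n (E i) := by
  induction s using Finset.induction_on with
  | empty => simp [Pr]
  | insert i s hi ih =>
    rw [set_biUnion_insert, sum_insert hi]
    exact (Pr_union_le _ _).trans (by gcongr)

lemma Pr_two_choices [NeZero n] (hn : 3 ≤ n) {x x' : Vx n} (hx : x ≠ x') (y y' : Vx n) :
    Pr n {c | c x = y ∧ c x' = y'} = choiceProb n x y * choiceProb n x' y' := by
  have key : ∀ c : Vx n → Vx n, c ∈ {c : Vx n → Vx n | c x = y ∧ c x' = y'} ↔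
      c ∈ Fintype.piFinset fun v => if v = x then {y} else if v = x' then {y'} else univ := by
    intro c
    rw [Fintype.mem_piFinset]
    constructor
    · rintro ⟨h1, h2⟩ v
      split_ifs with h h'
      · simp [h, h1]
      · simp [h', h2]
      · simp
    · intro h
      exact ⟨by simpa using h x, by simpa [hx.symm] using h x'⟩
  simp only [Pr, key, mass_eq_prod]
  rw [sum_ite_mem, univ_inter, ← prod_univ_sum, ← mul_prod_erase _ _ (mem_univ x),
    ← mul_prod_erase _ _ (mem_erase.2 ⟨hx.symm, mem_univ x'⟩), prod_eq_one]
  · simp [hx.symm]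
  · intro v hv
    simp only [mem_erase, mem_univ, and_true] at hv
    simp [hv.1, hv.2, sum_choiceProb hn]

lemma Pr_two_choices_le [NeZero n] (hn : 3 ≤ n) {x x' : Vx n} (hx : x ≠ x') (y y' : Vx n) :
    Pr n {c | c x = y ∧ c x' = y'} ≤ (4 * Real.log ((n : ℝ) / 2))⁻¹ ^ 2 *
      (((tdist n x y : ℝ) ^ 2)⁻¹ * ((tdist n x' y' : ℝ) ^ 2)⁻¹) := by
  have h1 := Zfac_le hn x
  have h2 := Zfac_le hn x'
  rw [Pr_two_choices hn hx]
  calc _ = (Zfac n x * Zfac n x') *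
        (((tdist n x y : ℝ) ^ 2)⁻¹ * ((tdist n x' y' : ℝ) ^ 2)⁻¹) := by
        unfold choiceProb; ring
    _ ≤ _ := by
        refine mul_le_mul_of_nonneg_right ?_ (by positivity)
        rw [sq]
        exact mul_le_mul h1 h2 (Zfac_nonneg x') ((Zfac_nonneg x).trans h1)

end Weights

section LocalPaths

variable {n : ℕ} [NeZero n]

lemma torusNorm_eq_one {w : Vx n} (h : torusNorm w = 1) :
    w = (1, 0) ∨ w = (-1, 0) ∨ w = (0, 1) ∨ w = (0, -1) := by
  obtain ⟨x, y⟩ := w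
  simp only [torusNorm] at h
  have h' : cycNorm x = 1 ∧ cycNorm y = 0 ∨ cycNorm x = 0 ∧ cycNorm y = 1 := by omega
  rcases h' with ⟨h1, h2⟩ | ⟨h1, h2⟩
  · rcases cycNorm_eq_one h1 with rfl | rfl <;> simp [cycNorm_eq_zero h2]
  · rcases cycNorm_eq_one h2 with rfl | rfl <;> simp [cycNorm_eq_zero h1]

/-- Vertices other than `u` joined to `u` by a path of two local edges. -/
noncomputable def twoStep (u : Vx n) : Finset (Vx n) :=
  {b | b ≠ u ∧ ∃ a, tdist n u a = 1 ∧ tdist n a b = 1}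

lemma card_twoStep_le (u : Vx n) : #(twoStep u) ≤ 8 := by
  refine (card_le_card (t := ([(1 + 1, 0), (-1 + -1, 0), (0, 1 + 1), (0, -1 + -1), (1, 1),
    (1, -1), (-1, 1), (-1, -1)].map fun w : Vx n => u - w).toFinset) fun b hb => ?_).trans
    (List.toFinset_card_le _)
  simp only [twoStep, mem_filter, mem_univ, true_and, tdist_eq_torusNorm] at hb
  obtain ⟨hbu, a, h1, h2⟩ := hb
  obtain ⟨w, hw⟩ : ∃ w, w = u - a := ⟨_, rfl⟩
  obtain ⟨w', hw'⟩ : ∃ w', w' = a - b := ⟨_, rfl⟩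
  have hb : b = u - (w + w') := by rw [hw, hw']; abel
  rw [← hw] at h1
  rw [← hw'] at h2
  rw [hb] at hbu ⊢
  rw [List.mem_toFinset]
  refine List.mem_map_of_mem (f := fun w : Vx n => u - w) ?_
  have hne : w + w' ≠ 0 := fun h => hbu (by rw [h, sub_zero])
  rcases torusNorm_eq_one h1 with rfl | rfl | rfl | rfl <;>
    rcases torusNorm_eq_one h2 with rfl | rfl | rfl | rfl <;> simp at hne ⊢

end LocalPaths

lemma edgeKind_symm {n : ℕ} {c : Vx n → Vx n} {x y : Vx n} {w : Bool}
    (h : edgeKind n c x y w) : edgeKind n c y x w := by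
  obtain ⟨⟨h1, h2⟩, h3⟩ := h
  rw [tdist_comm] at h2 h3
  exact ⟨⟨h1.symm, h2.imp_right Or.symm⟩, h3⟩

lemma cyclePat_reverse {n : ℕ} {c : Vx n → Vx n} {u : Vx n} {p₁ p₂ p₃ p₄ : Bool}
    (h : cyclePat n c u p₁ p₂ p₃ p₄) : cyclePat n c u p₄ p₃ p₂ p₁ := by
  obtain ⟨a, b, e, hab, hae, hbe, hau, hbu, heu, h1, h2, h3, h4⟩ := h
  exact ⟨e, b, a, hbe.symm, hae.symm, hab.symm, heu, hbu, hau, edgeKind_symm h4, edgeKind_symm h3,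
    edgeKind_symm h2, edgeKind_symm h1⟩

/-- The event that `b`, `e`, `u` is a path whose edges both come from long-range choices. -/
def longPath (n : ℕ) (u b e : Vx n) : Set (Vx n → Vx n) :=
  {c | b ≠ e ∧ e ≠ u ∧ b ≠ u ∧ (c b = e ∨ c e = b) ∧ (c e = u ∨ c u = e)}

lemma exists_longPath {n : ℕ} [NeZero n] {c : Vx n → Vx n} {u : Vx n}
    (h : cyclePat n c u false false true true) :
    c ∈ ⋃ b ∈ twoStep u, ⋃ e ∈ (univ : Finset (Vx n)), longPath n u b e := by
  obtain ⟨a, b, e, -, -, hbe, -, hbu, heu, h1, h2, h3, h4⟩ := h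
  simp only [edgeKind, isEdge, iff_true, Bool.true_eq_false, iff_false] at h1 h2 h3 h4
  simp only [Set.mem_iUnion]
  refine ⟨b, ?_, e, mem_univ e, hbe, heu, hbu, h3.1.2.resolve_left h3.2,
    h4.1.2.resolve_left h4.2⟩
  simp only [twoStep, mem_filter, mem_univ, true_and]
  exact ⟨hbu, a, h1.2, h2.2⟩

lemma Pr_longPath_le {n : ℕ} [NeZero n] (hn : 3 ≤ n) (u b e : Vx n) :
    Pr n (longPath n u b e) ≤ 3 * ((4 * Real.log ((n : ℝ) / 2))⁻¹ ^ 2 *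
      (((tdist n b e : ℝ) ^ 2)⁻¹ * ((tdist n u e : ℝ) ^ 2)⁻¹)) := by
  by_cases hd : b ≠ e ∧ e ≠ u ∧ b ≠ u
  · obtain ⟨hbe, heu, hbu⟩ := hd
    have hsub : longPath n u b e ⊆ ({c | c b = e ∧ c e = u} ∪ {c | c b = e ∧ c u = e}) ∪
        {c | c e = b ∧ c u = e} := by
      rintro c ⟨-, -, -, h1 | h1, h2 | h2⟩
      · exact Or.inl (Or.inl ⟨h1, h2⟩)
      · exact Or.inl (Or.inr ⟨h1, h2⟩)
      · exact absurd (h1.symm.trans h2) hbu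
      · exact Or.inr ⟨h1, h2⟩
    have h1 := Pr_two_choices_le hn hbe e u
    have h2 := Pr_two_choices_le hn hbu e e
    have h3 := Pr_two_choices_le hn heu b e
    rw [tdist_comm e u] at h1
    rw [tdist_comm e b] at h3
    linarith [Pr_mono hsub, Pr_union_le ({c | c b = e ∧ c e = u} ∪ {c | c b = e ∧ c u = e})
      {c | c e = b ∧ c u = e}, Pr_union_le {c : Vx n → Vx n | c b = e ∧ c e = u}
      {c | c b = e ∧ c u = e}]
  · have : longPath n u b e = ∅ := by
      ext c
      simp only [longPath, Set.mem_ofPred_eq, Set.mem_empty_iff_false, iff_false]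
      tauto
    rw [this]
    simp only [Pr, Set.mem_empty_iff_false, if_false, sum_const_zero]
    positivity

lemma sum_tdist_inv_sq_mul_le {n : ℕ} [NeZero n] (u b : Vx n) :
    ∑ e, ((tdist n b e : ℝ) ^ 2)⁻¹ * ((tdist n u e : ℝ) ^ 2)⁻¹ ≤ 4 * zeta3 := by
  have h (v : Vx n) : ∑ e, ((tdist n v e : ℝ) ^ 4)⁻¹ ≤ 4 * zeta3 := by
    rw [sum_comp_tdist fun i => ((i : ℝ) ^ 4)⁻¹]
    exact sum_torusNorm_inv_pow_four_le
  calc _ ≤ ∑ e, (((tdist n b e : ℝ) ^ 4)⁻¹ + ((tdist n u e : ℝ) ^ 4)⁻¹) / 2 := by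
        refine sum_le_sum fun e _ => ?_
        have := two_mul_le_add_sq (((tdist n b e : ℝ) ^ 2)⁻¹) (((tdist n u e : ℝ) ^ 2)⁻¹)
        simp only [inv_pow, ← pow_mul] at this
        norm_num at this
        linarith
    _ ≤ _ := by
        rw [← sum_div, sum_add_distrib]
        linarith [h b, h u]

/-- Probability bound for the event `E3ᵤ`. -/
theorem prob_E3 :
    ∀ n : ℕ, 3 ≤ n → ∀ u : Vx n,
      Pr n {c | cyclePat n c u false false true true ∨ cyclePat n c u true true false false} <
        (6 * zeta3 + 3 / 4) * (Real.log ((n : ℝ) / 2) ^ 2)⁻¹ := by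
  intro n hn u
  have : NeZero n := ⟨by omega⟩
  have hlog := log_half_pos hn
  have hzeta : 0 ≤ zeta3 := tsum_nonneg fun i => by positivity
  have hsub : {c | cyclePat n c u false false true true ∨ cyclePat n c u true true false false} ⊆
      ⋃ b ∈ twoStep u, ⋃ e ∈ (univ : Finset (Vx n)), longPath n u b e := by
    rintro c (h | h)
    exacts [exists_longPath h, exists_longPath (cyclePat_reverse h)]
  set L := Real.log ((n : ℝ) / 2)
  calc _ ≤ ∑ b ∈ twoStep u, ∑ e, Pr n (longPath n u b e) :=
        (Pr_mono hsub).trans ((Pr_biUnion_le _ _).trans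
          (sum_le_sum fun b _ => Pr_biUnion_le _ _))
    _ ≤ ∑ b ∈ twoStep u, 3 * ((4 * L)⁻¹ ^ 2 * (4 * zeta3)) := by
        refine sum_le_sum fun b _ => (sum_le_sum fun e _ => Pr_longPath_le hn u b e).trans ?_
        rw [← mul_sum, ← mul_sum]
        gcongr
        exact sum_tdist_inv_sq_mul_le u b
    _ ≤ 8 * (3 * ((4 * L)⁻¹ ^ 2 * (4 * zeta3))) := by
        rw [sum_const, nsmul_eq_mul]
        gcongr
        exact_mod_cast card_twoStep_le u
    _ = 6 * zeta3 * (L ^ 2)⁻¹ := by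
        field_simp
        ring
    _ < _ := by
        gcongr
        linarith
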